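/- Moment characterization of strength: a fraction F of {0,1}^d with N > 0 runs is an orthogonal array of strength t (1 ≤ t ≤ d) if and only if its moment vector satisfies μ(α) = 2^{−wt(α)} for every α ∈ {0,1}^d with 1 ≤ wt(α) ≤ t, where wt(α) is the number of coordinates of α equal to 1. -/

import Mathlib

open Finset

/-- A fraction with counting vector `v` on `{0,1}^d` is an orthogonal array of
strength `t` on `N` runs if `N = Σ_α v(α)` and for every `t`-subset `S` of
factors and every assignment `y` of levels to `S`, the number of runs agreeing
with `y` on `S` equals `N / 2^t`. -/
def IsOA (d t N : ℕ) (v : (Fin d → Bool) → ℕ) : Prop :=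
  (∑ α : Fin d → Bool, v α = N) ∧
  ∀ S : Finset (Fin d), S.card = t → ∀ y : Fin d → Bool,
    (∑ α ∈ Finset.univ.filter (fun α : Fin d → Bool => ∀ i ∈ S, α i = y i),
        (v α : ℝ)) = (N : ℝ) / 2 ^ t

/-- The moment vector of a pmf `p` on `{0,1}^d`. -/
noncomputable def moment (d : ℕ) (p : (Fin d → Bool) → ℝ) (α : Fin d → Bool) : ℝ :=
  ∑ β : Fin d → Bool, p β * ∏ i : Fin d,
    (if α i = true then (if β i = true then (1 : ℝ) else 0) else 1)

/-- The weight `wt(α)`: the number of coordinates of `α` equal to 1. -/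
def wt (d : ℕ) (α : Fin d → Bool) : ℕ :=
  (Finset.univ.filter (fun i : Fin d => α i = true)).card

section CylinderSum

variable {ι : Type*} [Fintype ι] [DecidableEq ι]

/-- The sum of `w` over all points of the cube that agree with `y` on `S`. -/
def cylinderSum (w : (ι → Bool) → ℝ) (S : Finset ι) (y : ι → Bool) : ℝ :=
  ∑ α ∈ Finset.univ.filter (fun α : ι → Bool => ∀ i ∈ S, α i = y i), w α

lemma cylinderSum_congr (w : (ι → Bool) → ℝ) {S : Finset ι} {y z : ι → Bool}
    (h : ∀ i ∈ S, y i = z i) : cylinderSum w S y = cylinderSum w S z := by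
  unfold cylinderSum
  congr 1
  ext α
  simp only [mem_filter, mem_univ, true_and]
  exact forall₂_congr fun i hi => by rw [h i hi]

lemma cylinderSum_empty (w : (ι → Bool) → ℝ) (y : ι → Bool) :
    cylinderSum w ∅ y = ∑ α, w α := by
  simp [cylinderSum]

lemma cylinderSum_eq_add (w : (ι → Bool) → ℝ) {S : Finset ι} {i : ι} (hi : i ∉ S)
    (y : ι → Bool) :
    cylinderSum w S y = cylinderSum w (insert i S) (Function.update y i true) +
      cylinderSum w (insert i S) (Function.update y i false) := by
  have key : ∀ b : Bool, cylinderSum w (insert i S) (Function.update y i b) =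
      ∑ α ∈ (Finset.univ.filter fun α : ι → Bool => ∀ j ∈ S, α j = y j).filter
        (fun α => α i = b), w α := by
    intro b
    unfold cylinderSum
    congr 1
    ext α
    simp only [mem_filter, mem_univ, true_and, forall_mem_insert, Function.update_self]
    rw [and_comm]
    refine and_congr_left fun _ => forall₂_congr fun j hj => ?_
    rw [Function.update_of_ne (ne_of_mem_of_not_mem hj hi)]
  rw [key, key, cylinderSum, ← sum_filter_add_sum_filter_not _ (fun α : ι → Bool => α i = true)]
  simp only [Bool.not_eq_true]

/-- Uniformity on all sets of size `t` passes to all smaller sets. -/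
lemma cylinderSum_of_card_le {w : (ι → Bool) → ℝ} {c : ℝ} {t : ℕ} (htd : t ≤ Fintype.card ι)
    (h : ∀ S : Finset ι, S.card = t → ∀ y, cylinderSum w S y = c / 2 ^ t)
    (S : Finset ι) (hS : S.card ≤ t) (y : ι → Bool) :
    cylinderSum w S y = c / 2 ^ S.card := by
  induction hn : t - S.card generalizing S y with
  | zero =>
    have hc : S.card = t := by omega
    rw [h S hc, hc]
  | succ n ih =>
    obtain ⟨i, hi⟩ : ∃ i, i ∉ S := by
      by_contra! hall
      have : S.card = Fintype.card ι := by rw [eq_univ_of_forall hall, card_univ]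
      omega
    have hc := card_insert_of_notMem hi
    rw [cylinderSum_eq_add w hi, ih _ (by omega) _ (by omega), ih _ (by omega) _ (by omega), hc,
      pow_succ]
    field_simp
    norm_num

/-- Cylinder sums with all levels `true` determine all cylinder sums. -/
lemma cylinderSum_of_true {w : (ι → Bool) → ℝ} {c : ℝ} {t : ℕ}
    (h : ∀ S : Finset ι, S.card ≤ t → cylinderSum w S (fun _ => true) = c / 2 ^ S.card)
    (S : Finset ι) (hS : S.card ≤ t) (y : ι → Bool) :
    cylinderSum w S y = c / 2 ^ S.card := by
  induction hn : (S.filter fun i => y i = false).card generalizing S y with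
  | zero =>
    rw [← h S hS]
    refine cylinderSum_congr w fun i hi => ?_
    simpa using (filter_eq_empty_iff.mp (card_eq_zero.mp hn)) hi
  | succ n ih =>
    obtain ⟨i, hi⟩ := card_pos.mp (by omega : 0 < (S.filter fun i => y i = false).card)
    obtain ⟨hiS, hiy⟩ := mem_filter.mp hi
    have hcard := card_erase_add_one hiS
    have hsplit := cylinderSum_eq_add w (notMem_erase i S) y
    rw [insert_erase hiS, ← hiy, Function.update_eq_self] at hsplit
    have hfilter : ((S.filter fun j => y j = false).erase i).card = n := by
      rw [card_erase_of_mem hi, hn, Nat.add_sub_cancel]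
    have h₁ := ih (S.erase i) (by omega) y (by rwa [filter_erase])
    have h₂ := ih S hS (Function.update y i true) (by
      rw [← hfilter]
      congr 1
      ext j
      by_cases hj : j = i <;> simp [hj])
    rw [h₁, h₂] at hsplit
    rw [eq_sub_of_add_eq' hsplit.symm, ← hcard, pow_succ]
    field_simp
    norm_num

end CylinderSum

lemma isOA_iff_cylinderSum {d t N : ℕ} {v : (Fin d → Bool) → ℕ} :
    IsOA d t N v ↔ (∑ α, v α = N) ∧ ∀ S : Finset (Fin d), S.card = t → ∀ y,
      cylinderSum (fun α => (v α : ℝ)) S y = N / 2 ^ t := by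
  unfold IsOA cylinderSum
  congr!

lemma moment_eq_cylinderSum (d : ℕ) (p : (Fin d → Bool) → ℝ) (α : Fin d → Bool) :
    moment d p α =
      cylinderSum p (Finset.univ.filter fun i => α i = true) (fun _ => true) := by
  rw [moment, cylinderSum, sum_filter]
  refine sum_congr rfl fun β _ => ?_
  rw [← prod_filter, prod_ite_zero]
  simp

lemma moment_div_eq_inv_iff {d : ℕ} {w : (Fin d → Bool) → ℝ} {c : ℝ} (hc : c ≠ 0)
    (α : Fin d → Bool) :
    moment d (fun β => w β / c) α = ((2 : ℝ) ^ wt d α)⁻¹ ↔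
      cylinderSum w (Finset.univ.filter fun i => α i = true) (fun _ => true) =
        c / 2 ^ wt d α := by
  rw [moment_eq_cylinderSum, cylinderSum, cylinderSum, ← sum_div, div_eq_iff hc,
    inv_mul_eq_div]

/-- moment characterization of strength: a fraction with `N > 0`
runs is an OA of strength `t` (`1 ≤ t ≤ d`) iff its moment vector satisfies
`μ(α) = 2^{-wt(α)}` for every `α` with `1 ≤ wt(α) ≤ t`. -/
theorem isOA_iff_moments (d t N : ℕ) (ht1 : 1 ≤ t) (htd : t ≤ d) (hN : 0 < N)
    (v : (Fin d → Bool) → ℕ) (hsum : ∑ α : Fin d → Bool, v α = N) :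
    IsOA d t N v ↔
      ∀ α : Fin d → Bool, 1 ≤ wt d α → wt d α ≤ t →
        moment d (fun β => (v β : ℝ) / N) α = ((2 : ℝ) ^ wt d α)⁻¹ := by
  have hN' : (N : ℝ) ≠ 0 := Nat.cast_ne_zero.mpr hN.ne'
  rw [isOA_iff_cylinderSum]
  constructor
  · rintro ⟨-, h⟩ α - hα
    exact (moment_div_eq_inv_iff hN' α).mpr
      (cylinderSum_of_card_le (by simpa using htd) h _ hα _)
  · refine fun h => ⟨hsum, fun S hS y => ?_⟩
    rw [← hS]
    refine cylinderSum_of_true (t := t) (fun T hT => ?_) S hS.le y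
    rcases T.eq_empty_or_nonempty with rfl | hne
    · rw [cylinderSum_empty, ← hsum]
      simp
    · have hsupp : (Finset.univ.filter fun i => decide (i ∈ T) = true) = T := by
        ext
        simp
      have hwt : wt d (fun i => decide (i ∈ T)) = T.card := by rw [wt, hsupp]
      have hT' := (moment_div_eq_inv_iff hN' _).mp
        (h (fun i => decide (i ∈ T)) (hwt ▸ hne.card_pos) (hwt ▸ hT))
      rwa [hsupp, hwt] at hT'
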